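/- Let n ≥ 1. The one-relator presented group ⟨x, t | ρ_n(x,t)⟩ is locally indicable: every nontrivial finitely generated subgroup admits a surjective homomorphism onto ℤ. -/

import Mathlib

/-- The word `ρ_k(x,t) = (t x t⁻¹) x (t x t⁻¹)⁻¹ x^{-(k+1)}`, evaluated at elements
`x`, `t` of a group. -/
def rhoWord {G : Type*} [Group G] (k : ℕ) (x t : G) : G :=
  (t * x * t⁻¹) * x * (t * x * t⁻¹)⁻¹ * x ^ (-(k + 1 : ℤ))

/-- A group is locally indicable if each of its nontrivial finitely generated subgroups
admits a surjective homomorphism onto the infinite cyclic group `ℤ`. -/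
def LocallyIndicable (G : Type*) [Group G] : Prop :=
  ∀ H : Subgroup G, H ≠ ⊥ → H.FG → ∃ f : H →* Multiplicative ℤ, Function.Surjective f

namespace HNNExtension

variable {G : Type*} [Group G] {A B : Subgroup G} {φ : A ≃* B}

/-- The element represented by a list of letters `t^{±1} a`, where `true` stands for `t`. -/
def wordProd (φ : A ≃* B) (l : List (Bool × G)) : HNNExtension G A B φ :=
  (l.map fun p => cond p.1 t t⁻¹ * of p.2).prod

@[simp]
theorem wordProd_nil : wordProd φ [] = 1 := rfl

@[simp]
theorem wordProd_cons (p : Bool × G) (l : List (Bool × G)) :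
    wordProd φ (p :: l) = cond p.1 t t⁻¹ * of p.2 * wordProd φ l := by
  simp [wordProd]

@[simp]
theorem wordProd_append (l m : List (Bool × G)) :
    wordProd φ (l ++ m) = wordProd φ l * wordProd φ m := by
  simp [wordProd]

theorem exists_eq_of_mul_wordProd (g : HNNExtension G A B φ) :
    ∃ a l, g = of a * wordProd φ l := by
  suffices h : ∀ h : HNNExtension G A B φ, (∃ a l, h = of a * wordProd φ l) →
      (∃ a l, g * h = of a * wordProd φ l) ∧ (∃ a l, g⁻¹ * h = of a * wordProd φ l) by
    simpa using (h 1 ⟨1, [], by simp⟩).1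
  induction g using HNNExtension.induction_on with
  | of g =>
    rintro _ ⟨a, l, rfl⟩
    exact ⟨⟨g * a, l, by simp [mul_assoc]⟩, ⟨g⁻¹ * a, l, by simp [mul_assoc]⟩⟩
  | t =>
    rintro _ ⟨a, l, rfl⟩
    exact ⟨⟨1, (true, a) :: l, by simp [mul_assoc]⟩, ⟨1, (false, a) :: l, by simp [mul_assoc]⟩⟩
  | mul x y hx hy =>
    intro h hh
    refine ⟨?_, ?_⟩
    · rw [mul_assoc]
      exact (hx _ (hy _ hh).1).1
    · rw [mul_inv_rev, mul_assoc]
      exact (hy _ (hx _ hh).2).2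
  | inv x hx =>
    intro h hh
    exact ⟨(hx h hh).2, by simpa using (hx h hh).1⟩

/-- `g` is conjugate to an element whose expression involves `k` occurrences of `t^{±1}`. -/
def ConjToLength (g : HNNExtension G A B φ) (k : ℕ) : Prop :=
  ∃ z a l, l.length = k ∧ z * g * z⁻¹ = of a * wordProd φ l

theorem conjToLength_of_mul_wordProd (a b : G) (l : List (Bool × G)) :
    ConjToLength (of a * wordProd φ l * of b) l.length :=
  ⟨of b, b * a, l, rfl, by simp [mul_assoc]⟩

theorem ConjToLength.of_conj {g : HNNExtension G A B φ} {k : ℕ} (z : HNNExtension G A B φ)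
    (h : ConjToLength (z * g * z⁻¹) k) : ConjToLength g k := by
  obtain ⟨y, a, l, hl, e⟩ := h
  exact ⟨y * z, a, l, hl, by rw [← e]; group⟩

/-- The homomorphism to the wreath product whose first coordinate counts, with signs and weighted
by `χ`, the edges crossed in the Bass–Serre tree. -/
def edgeCount (χ : HNNExtension G A B φ → Multiplicative ℚ)
    (hχ : ∀ y, ∀ b : B, χ (y * of (b : G)) = χ y) :
    HNNExtension G A B φ →* Multiplicative ℚ ≀ᵣ HNNExtension G A B φ :=
  lift (RegularWreathProduct.inl.comp of) ⟨fun y => χ y⁻¹, t⟩ fun a => by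
    ext y
    · simp [hχ]
    · simp [t_mul_of]

section

variable (χ : HNNExtension G A B φ → Multiplicative ℚ) (hχ : ∀ y, ∀ b : B, χ (y * of (b : G)) = χ y)

@[simp]
theorem edgeCount_right (g : HNNExtension G A B φ) : (edgeCount χ hχ g).right = g := by
  have : RegularWreathProduct.rightHom.comp (edgeCount χ hχ) = MonoidHom.id _ := by
    ext g <;> simp [edgeCount]
  exact DFunLike.congr_fun this g

@[simp]
theorem edgeCount_of_left (a : G) : (edgeCount χ hχ (of a)).left = 1 := by
  simp [edgeCount]

@[simp]
theorem edgeCount_t_left (y : HNNExtension G A B φ) : (edgeCount χ hχ t).left y = χ y⁻¹ := by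
  simp [edgeCount]

theorem edgeCount_left_mul_right {H : Subgroup (HNNExtension G A B φ)}
    (hH : ∀ h ∈ H, ∀ y, χ (h * y) = χ y) (g y : HNNExtension G A B φ) {h} (hh : h ∈ H) :
    (edgeCount χ hχ g).left (y * h) = (edgeCount χ hχ g).left y := by
  induction g using HNNExtension.induction_on generalizing y with
  | of g => simp
  | t => simp [hH _ (H.inv_mem hh)]
  | mul a b ha hb => simp [ha, ← mul_assoc, hb]
  | inv a ha => simp [← mul_assoc, ha]

/-- For a weight `χ` that is invariant under `H`, counting edges is a homomorphism on `H`. -/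
def edgeCountHom (H : Subgroup (HNNExtension G A B φ)) (hH : ∀ h ∈ H, ∀ y, χ (h * y) = χ y) :
    H →* Multiplicative ℚ where
  toFun h := (edgeCount χ hχ h).left 1
  map_one' := by simp
  map_mul' a b := by
    simpa using edgeCount_left_mul_right χ hχ hH b 1 (H.inv_mem a.2)

theorem edgeCount_wordProd_append_left (l m : List (Bool × G))
    (h : ∀ m₁ u a m₂, m = m₁ ++ (u, a) :: m₂ →
      χ (wordProd φ (l ++ m₁) * cond u 1 t⁻¹) = 1) :
    (edgeCount χ hχ (wordProd φ (l ++ m))).left 1 = (edgeCount χ hχ (wordProd φ l)).left 1 := by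
  induction m generalizing l with
  | nil => simp
  | cons p m ih =>
    have key := ih (l ++ [p]) fun m₁ u a m₂ e => by
      simpa using h (p :: m₁) u a m₂ (by simp [e])
    rw [List.append_assoc, List.singleton_append] at key
    rw [key]
    have h0 := h [] p.1 p.2 m rfl
    obtain ⟨u, a⟩ := p
    cases u <;> simp_all

end

open Classical in
theorem exists_hom_of_minimal {H : Subgroup (HNNExtension G A B φ)} {l : List (Bool × G)} {a₀ : G}
    (hl : l ≠ []) (hu : wordProd φ l * of a₀ ∈ H)
    (hmin : ∀ h ∈ H, ∀ k < l.length, ConjToLength h k → h = 1)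
    (hne : wordProd φ l * of a₀ ≠ 1) :
    ∃ f : H →* Multiplicative ℚ, f ≠ 1 := by
  obtain ⟨⟨u, a⟩, l, rfl⟩ := List.exists_cons_of_ne_nil hl
  set χ : HNNExtension G A B φ → Multiplicative ℚ := fun y =>
    if ∃ h ∈ H, ∃ b : B, y = h * cond u 1 t⁻¹ * of (b : G) then Multiplicative.ofAdd 1
      else 1 with hχd
  have hχ : ∀ y, ∀ b : B, χ (y * of (b : G)) = χ y := by
    intro y b
    simp only [hχd]
    congr 1
    apply propext
    constructor
    · rintro ⟨h, hh, c, e⟩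
      refine ⟨h, hh, c * b⁻¹, ?_⟩
      rw [Subgroup.coe_mul, map_mul, ← mul_assoc, ← e]
      simp
    · rintro ⟨h, hh, c, rfl⟩
      exact ⟨h, hh, c * b, by simp [mul_assoc]⟩
  have hH : ∀ h ∈ H, ∀ y, χ (h * y) = χ y := by
    intro h hh y
    simp only [hχd]
    congr 1
    apply propext
    constructor
    · rintro ⟨k, hk, c, e⟩
      exact ⟨h⁻¹ * k, H.mul_mem (H.inv_mem hh) hk, c, by
        rw [mul_assoc, mul_assoc, ← mul_assoc k, ← e]; simp⟩
    · rintro ⟨k, hk, c, rfl⟩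
      exact ⟨h * k, H.mul_mem hh hk, c, by simp [mul_assoc]⟩
  refine ⟨edgeCountHom χ hχ H hH, fun e => ?_⟩
  have e1 := DFunLike.congr_fun e ⟨_, hu⟩
  have e2 : (edgeCount χ hχ (wordProd φ ((u, a) :: l))).left 1 = 1 := by
    simpa [edgeCountHom] using e1
  have hχu : χ (cond u 1 t⁻¹) = Multiplicative.ofAdd 1 :=
    if_pos ⟨1, H.one_mem, 1, by simp⟩
  have e3 : (edgeCount χ hχ (wordProd φ [(u, a)])).left 1 ≠ 1 := by
    cases u <;> simp only [cond_true, cond_false] at hχu <;> simp [hχu]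
  refine e3 (e2 ▸ (edgeCount_wordProd_append_left χ hχ [(u, a)] l ?_).symm)
  rintro m₁ v b m₂ rfl
  refine if_neg ?_
  rintro ⟨h, hh, c, e⟩
  have hshort : ∀ d : G, wordProd φ ((u, a) :: m₁) * cond v t t⁻¹ = of d → False := fun d hd => by
    refine hne (hmin _ hu m₂.length (by simp; omega) ?_)
    have := conjToLength_of_mul_wordProd (φ := φ) (d * b) a₀ m₂
    rwa [map_mul, ← hd, show wordProd φ ((u, a) :: m₁) * cond v t t⁻¹ * of b * wordProd φ m₂ =
      wordProd φ ((u, a) :: (m₁ ++ (v, b) :: m₂)) by simp [mul_assoc]] at this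
  have hshort' : ∀ d : G, wordProd φ ((u, a) :: m₁) = of d → False := fun d hd => by
    refine hne (hmin _ hu (m₂.length + 1) (by simp) ?_)
    have := conjToLength_of_mul_wordProd (φ := φ) d a₀ ((v, b) :: m₂)
    rwa [← hd, show wordProd φ ((u, a) :: m₁) * wordProd φ ((v, b) :: m₂) =
      wordProd φ ((u, a) :: (m₁ ++ (v, b) :: m₂)) by simp [mul_assoc]] at this
  cases u <;> cases v <;> simp only [cond_true, cond_false, mul_one,
    List.singleton_append] at e hshort
  · -- both letters are `t⁻¹`
    have e' : h = wordProd φ ((false, a) :: m₁) * of (φ.symm c⁻¹ : G) := by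
      rw [equiv_symm_eq_conj, Subgroup.coe_inv, map_inv, ← mul_assoc, ← mul_assoc, e]; group
    have h1 : h = 1 := hmin h hh (m₁.length + 1) (by simp) (by
      simpa [e'] using conjToLength_of_mul_wordProd (φ := φ) 1 (φ.symm c⁻¹ : G) ((false, a) :: m₁))
    refine hshort' ((φ.symm c⁻¹ : G)⁻¹) ?_
    rw [map_inv]
    exact eq_inv_of_mul_eq_one_left (e'.symm.trans h1)
  · -- `t⁻¹` followed by `t`
    have e' : t * h * t⁻¹ = of a * wordProd φ m₁ * of (c⁻¹ : G) := by
      rw [wordProd_cons] at e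
      have : h = t⁻¹ * of a * wordProd φ m₁ * (of (c : G))⁻¹ * t := by
        simp only [cond_false] at e
        rw [e]; group
      rw [this, map_inv]; group
    have h1 : h = 1 := hmin h hh m₁.length (by simp) (.of_conj t (by
      rw [e']; exact conjToLength_of_mul_wordProd _ _ _))
    refine hshort (φ.symm c) ?_
    rw [e, h1, equiv_symm_eq_conj, one_mul]
  · -- `t` followed by `t⁻¹`
    have e' : t⁻¹ * h * t⁻¹⁻¹ = of a * wordProd φ m₁ * of (φ.symm c⁻¹ : G) := by
      rw [wordProd_cons] at e
      have : h = t * of a * wordProd φ m₁ * t⁻¹ * (of (c : G))⁻¹ := by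
        simp only [cond_true] at e
        rw [e]; group
      rw [this, equiv_symm_eq_conj, Subgroup.coe_inv, map_inv]; group
    have h1 : h = 1 := hmin h hh m₁.length (by simp) (.of_conj t⁻¹ (by
      rw [e']; exact conjToLength_of_mul_wordProd _ _ _))
    exact hshort c (by rw [e, h1, one_mul])
  · -- both letters are `t`
    have e' : h = wordProd φ ((true, a) :: m₁) * of (c⁻¹ : G) := by
      rw [e, map_inv]; group
    have h1 : h = 1 := hmin h hh (m₁.length + 1) (by simp) (by
      simpa [e'] using conjToLength_of_mul_wordProd (φ := φ) 1 (c⁻¹ : G) ((true, a) :: m₁))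
    exact hshort' c (by rw [e, h1, one_mul])

/-- A nontrivial subgroup of an HNN extension meeting no conjugate of the base group acts freely on
the Bass–Serre tree, hence has a nontrivial homomorphism to a torsion-free abelian group. -/
theorem exists_hom_of_free {H : Subgroup (HNNExtension G A B φ)} (hH : H ≠ ⊥)
    (hfree : ∀ g a, g * of a * g⁻¹ ∈ H → g * of a * g⁻¹ = 1) :
    ∃ f : H →* Multiplicative ℚ, f ≠ 1 := by
  classical
  have hex : ∃ k, ∃ h ∈ H, h ≠ 1 ∧ ConjToLength h k := by
    obtain ⟨h, hh, h1⟩ := H.bot_or_exists_ne_one.resolve_left hH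
    obtain ⟨a, l, e⟩ := exists_eq_of_mul_wordProd h
    exact ⟨l.length, h, hh, h1, 1, a, l, rfl, by simpa using e⟩
  obtain ⟨h, hh, h1, z, a, l, hl, e⟩ := Nat.find_spec hex
  have hmem : ∀ {x}, x ∈ H.map (MulAut.conj ((of a)⁻¹ * z)).toMonoidHom →
      ((of a)⁻¹ * z)⁻¹ * x * ((of a)⁻¹ * z)⁻¹⁻¹ ∈ H := by
    rintro _ ⟨y, hy, rfl⟩
    simpa [mul_assoc] using hy
  have hconj : wordProd φ l * of a = (MulAut.conj ((of a)⁻¹ * z)) h := by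
    have : wordProd φ l = (of a)⁻¹ * (z * h * z⁻¹) := by rw [e]; group
    rw [this]; simp [mul_assoc]
  obtain ⟨f, hf⟩ := exists_hom_of_minimal (H := H.map (MulAut.conj ((of a)⁻¹ * z)).toMonoidHom)
    (l := l) (a₀ := a) (by
      rintro rfl
      have : h = z⁻¹ * of a * z⁻¹⁻¹ := by
        rw [wordProd_nil, mul_one] at e
        rw [← e]; group
      exact h1 (this ▸ hfree _ _ (this ▸ hh)))
    ⟨h, hh, hconj.symm⟩
    (fun x hx k hk hxk => by
      by_contra hx1
      refine Nat.find_min hex (m := k) (hl ▸ hk) ⟨_, hmem hx, ?_, .of_conj ((of a)⁻¹ * z) ?_⟩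
      · exact fun hc => hx1 (conj_eq_one_iff.1 hc)
      · convert hxk using 1
        group)
    (by rw [hconj]; exact fun hc => h1 ((map_eq_one_iff _ (MulEquiv.injective _)).1 hc))
  refine ⟨f.comp ((MulAut.conj ((of a)⁻¹ * z)).toMonoidHom.subgroupMap H), fun hc => hf ?_⟩
  ext x
  obtain ⟨y, rfl⟩ := MonoidHom.subgroupMap_surjective _ H x
  exact DFunLike.congr_fun hc y

end HNNExtension

/-- Every nontrivial subgroup has a nontrivial homomorphism to the additive group of `ℚ`. -/
def RationallyIndicable (G : Type*) [Group G] : Prop :=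
  ∀ H : Subgroup G, H ≠ ⊥ → ∃ f : H →* Multiplicative ℚ, f ≠ 1

theorem MonoidHom.ne_one_iff_exists {G Q : Type*} [Group G] [Group Q] {f : G →* Q} :
    f ≠ 1 ↔ ∃ g, f g ≠ 1 := by
  rw [Ne, MonoidHom.ext_iff]
  push Not
  rfl

namespace RationallyIndicable

theorem exists_hom {G Q : Type*} [Group G] [Group Q] (hQ : RationallyIndicable Q) (f : G →* Q)
    (hf : f ≠ 1) : ∃ g : G →* Multiplicative ℚ, g ≠ 1 := by
  obtain ⟨g, hg⟩ := hQ f.range (by rwa [Ne, MonoidHom.range_eq_bot_iff])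
  refine ⟨g.comp f.rangeRestrict, fun h => hg ?_⟩
  ext x
  obtain ⟨y, rfl⟩ := f.rangeRestrict_surjective x
  exact DFunLike.congr_fun h y

theorem multiplicative_rat : RationallyIndicable (Multiplicative ℚ) := fun H hH => by
  obtain ⟨h, hh, h1⟩ := H.bot_or_exists_ne_one.resolve_left hH
  exact ⟨H.subtype, MonoidHom.ne_one_iff_exists.2 ⟨⟨h, hh⟩, h1⟩⟩

theorem multiplicative_int : RationallyIndicable (Multiplicative ℤ) := fun H hH => by
  obtain ⟨h, hh, h1⟩ := H.bot_or_exists_ne_one.resolve_left hH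
  refine ⟨(AddMonoidHom.toMultiplicative (Int.castAddHom ℚ)).comp H.subtype,
    MonoidHom.ne_one_iff_exists.2 ⟨⟨h, hh⟩, fun e => h1 ?_⟩⟩
  have : ((Multiplicative.toAdd h : ℤ) : ℚ) = 0 := e
  exact Multiplicative.toAdd.injective (Int.cast_eq_zero.1 this)

theorem regularWreathProduct {D Q : Type*} [Group D] [Group Q] (hD : RationallyIndicable D)
    (hQ : RationallyIndicable Q) : RationallyIndicable (D ≀ᵣ Q) := fun H hH => by
  by_cases hr : RegularWreathProduct.rightHom.comp H.subtype = 1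
  · have hr' : ∀ h : H, (h : D ≀ᵣ Q).right = 1 := fun h => DFunLike.congr_fun hr h
    obtain ⟨h, hh, h1⟩ := H.bot_or_exists_ne_one.resolve_left hH
    obtain ⟨y, hy⟩ : ∃ y, h.left y ≠ 1 := by
      by_contra! hc
      exact h1 (RegularWreathProduct.ext (funext hc) (hr' ⟨h, hh⟩))
    let f : H →* D :=
      { toFun := fun h => (h : D ≀ᵣ Q).left y
        map_one' := by simp
        map_mul' := fun a b => by simp [hr'] }
    exact hD.exists_hom f (MonoidHom.ne_one_iff_exists.2 ⟨⟨h, hh⟩, hy⟩)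
  · exact hQ.exists_hom _ hr

theorem semidirectProduct {D Q : Type*} [Group D] [Group Q] {φ : Q →* MulAut D}
    (hD : RationallyIndicable D) (hQ : RationallyIndicable Q) :
    RationallyIndicable (D ⋊[φ] Q) := fun H hH => by
  by_cases hr : SemidirectProduct.rightHom.comp H.subtype = 1
  · have hr' : ∀ h : H, (h : D ⋊[φ] Q).right = 1 := fun h => DFunLike.congr_fun hr h
    obtain ⟨h, hh, h1⟩ := H.bot_or_exists_ne_one.resolve_left hH
    let f : H →* D :=
      { toFun := fun h => (h : D ⋊[φ] Q).left
        map_one' := by simp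
        map_mul' := fun a b => by simp [hr'] }
    exact hD.exists_hom f (MonoidHom.ne_one_iff_exists.2
      ⟨⟨h, hh⟩, fun e => h1 (SemidirectProduct.ext e (hr' ⟨h, hh⟩))⟩)
  · exact hQ.exists_hom _ hr

end RationallyIndicable

/-- The affine group `ℚ ⋊ ℤ`, with `ℤ` acting through powers of `N`, together with the integral
part of the translation coordinate. -/
theorem exists_affine_group (N : ℕ) (hN : N ≠ 0) :
    ∃ (B : Type) (_ : Group B) (x s : B) (e : B → ℤ), RationallyIndicable B ∧
      s * x * s⁻¹ = x ^ N ∧ ∀ y, e (x * y) = e y + 1 := by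
  let α : MulAut (Multiplicative ℚ) :=
    AddEquiv.toMultiplicative (AddAut.mulLeft (Units.mk0 (N : ℚ) (by exact_mod_cast hN)))
  let ψ : Multiplicative ℤ →* MulAut (Multiplicative ℚ) := zpowersHom _ α
  refine ⟨Multiplicative ℚ ⋊[ψ] Multiplicative ℤ, inferInstance,
    SemidirectProduct.inl (Multiplicative.ofAdd 1), SemidirectProduct.inr (Multiplicative.ofAdd 1),
    fun y => ⌊Multiplicative.toAdd y.left⌋,
    .semidirectProduct .multiplicative_rat .multiplicative_int, ?_, fun y => ?_⟩
  · rw [← map_inv, ← SemidirectProduct.inl_aut, ← map_pow]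
    congr 1
  · simp [add_comm (1 : ℚ)]

section RangeEquiv

variable {K G Γ : Type*} [Group K] [Group G] [Group Γ]

/-- The isomorphism between the images of two embeddings of the same group. -/
noncomputable def rangeEquiv (i j : K →* G) (hi : Function.Injective i)
    (hj : Function.Injective j) : i.range ≃* j.range :=
  (MonoidHom.ofInjective hi).symm.trans (MonoidHom.ofInjective hj)

variable {i j : K →* G} {hi : Function.Injective i} {hj : Function.Injective j}

theorem rangeEquiv_apply (k : K) :
    rangeEquiv i j hi hj ⟨i k, k, rfl⟩ = ⟨j k, k, rfl⟩ := by
  have : (MonoidHom.ofInjective hi).symm ⟨i k, k, rfl⟩ = k :=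
    (MonoidHom.ofInjective hi).symm_apply_apply k
  simp only [rangeEquiv, MulEquiv.trans_apply, this]
  rfl

theorem t_mul_of_rangeEquiv (k : K) :
    (HNNExtension.t * HNNExtension.of (i k) : HNNExtension G _ _ (rangeEquiv i j hi hj)) =
      HNNExtension.of (j k) * HNNExtension.t := by
  have := HNNExtension.t_mul_of (φ := rangeEquiv i j hi hj) ⟨i k, k, rfl⟩
  rwa [rangeEquiv_apply] at this

theorem rangeEquiv_compatible (f : G →* Γ) (x : Γ) (h : ∀ k, x * f (i k) = f (j k) * x)
    (a : i.range) : x * f a = f (rangeEquiv i j hi hj a : G) * x := by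
  obtain ⟨_, k, rfl⟩ := a
  rw [rangeEquiv_apply]
  exact h k

end RangeEquiv

/-- The group generated by `x₀, x₁, …` subject to `xᵢ xᵢ₊₁ xᵢ⁻¹ = xᵢ₊₁ ^ N`. -/
abbrev ChainGroup (N : ℕ) : Type :=
  PresentedGroup (Set.range fun i : ℕ => FreeGroup.of i * FreeGroup.of (i + 1) *
    (FreeGroup.of i)⁻¹ * (FreeGroup.of (i + 1) ^ N)⁻¹)

namespace ChainGroup

variable {N : ℕ} {Γ : Type*} [Group Γ]

/-- The generators of `ChainGroup N`. -/
def gen (i : ℕ) : ChainGroup N := PresentedGroup.of i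

theorem gen_rel (i : ℕ) : (gen i * gen (i + 1) * (gen i)⁻¹ : ChainGroup N) = gen (i + 1) ^ N :=
  PresentedGroup.mk_eq_mk_of_mul_inv_mem (Set.mem_range_self i)

/-- The homomorphism determined by the images of the generators. -/
def lift (y : ℕ → Γ) (h : ∀ i, y i * y (i + 1) * (y i)⁻¹ = y (i + 1) ^ N) : ChainGroup N →* Γ :=
  PresentedGroup.toGroup (f := y) (by
    rintro _ ⟨i, rfl⟩
    simp [h])

@[simp]
theorem lift_gen (y : ℕ → Γ) (h : ∀ i, y i * y (i + 1) * (y i)⁻¹ = y (i + 1) ^ N) (i : ℕ) :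
    lift y h (gen i) = y i :=
  PresentedGroup.toGroup.of _

theorem hom_ext {f g : ChainGroup N →* Γ} (h : ∀ i, f (gen i) = g (gen i)) : f = g :=
  PresentedGroup.ext h

/-- The exponent sum of `x₀`. -/
def deg : ChainGroup N →* Multiplicative ℤ :=
  lift (fun i => if i = 0 then Multiplicative.ofAdd 1 else 1) (by simp)

/-- The endomorphism `xᵢ ↦ xᵢ₊₁`. -/
def shift : ChainGroup N →* ChainGroup N :=
  lift (fun i => gen (i + 1)) fun i => gen_rel (i + 1)

/-- The retraction killing `xᵢ` for `m ≤ i`. -/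
def trunc (m : ℕ) : ChainGroup N →* ChainGroup N :=
  lift (fun i => if i < m then gen i else 1) fun i => by
    by_cases h : i + 1 < m
    · simp [h, show i < m by omega, gen_rel]
    · simp [h]

theorem trunc_trunc (m : ℕ) (a : ChainGroup N) : trunc m (trunc m a) = trunc m a := by
  refine DFunLike.congr_fun (hom_ext (f := (trunc m).comp (trunc m)) fun i => ?_) a
  by_cases h : i < m <;> simp [trunc, h]

theorem trunc_shift (m : ℕ) (a : ChainGroup N) :
    trunc (m + 1) (shift a) = shift (trunc m a) := by
  refine DFunLike.congr_fun (hom_ext (f := (trunc (m + 1)).comp shift) (g := shift.comp (trunc m))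
    fun i => ?_) a
  by_cases h : i < m <;> simp [trunc, shift, h]

theorem eventually_trunc_eq (a : ChainGroup N) : ∀ᶠ m in Filter.atTop, trunc m a = a := by
  let S : Subgroup (ChainGroup N) :=
    { carrier := {a | ∀ᶠ m in Filter.atTop, trunc m a = a}
      one_mem' := by simp
      mul_mem' := fun ha hb => by
        filter_upwards [ha, hb] with m h1 h2
        rw [map_mul, h1, h2]
      inv_mem' := fun ha => by
        filter_upwards [ha] with m h1
        rw [map_inv, h1] }
  refine PresentedGroup.generated_by _ S (fun i => ?_) a
  filter_upwards [Filter.eventually_gt_atTop i] with m hm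
  change trunc m (gen i) = gen i
  simp [trunc, hm]

theorem gen_zero_zpow_injective :
    Function.Injective (zpowersHom (ChainGroup N) (gen 0)) := by
  have h : (deg (N := N)).comp (zpowersHom _ (gen 0)) = MonoidHom.id _ := by
    ext
    simp [deg]
  exact Function.LeftInverse.injective (g := deg) (DFunLike.congr_fun h)

theorem gen_zero_pow_zpow_injective (hN : N ≠ 0) :
    Function.Injective (zpowersHom (ChainGroup N) (gen 0 ^ N)) := by
  have h : zpowersHom (ChainGroup N) (gen 0 ^ N) =
      (zpowersHom _ (gen 0)).comp (powMonoidHom N) := by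
    ext
    simp
  rw [h, MonoidHom.coe_comp]
  exact gen_zero_zpow_injective.comp (pow_left_injective hN)

section HNN

variable (hN : N ≠ 0)

/-- The HNN extension of `ChainGroup N` along `x₀ ↦ x₀ ^ N`. -/
abbrev Extension : Type :=
  HNNExtension (ChainGroup N) _ _
    (rangeEquiv _ _ gen_zero_zpow_injective (gen_zero_pow_zpow_injective hN))

/-- The map identifying `x₀` with the stable letter and `xᵢ₊₁` with the old `xᵢ`. -/
noncomputable def toExtension : ChainGroup N →* Extension hN :=
  lift (fun i => Nat.casesOn i HNNExtension.t fun i => HNNExtension.of (gen i)) fun i => by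
    cases i with
    | zero =>
      have := t_mul_of_rangeEquiv (hi := gen_zero_zpow_injective)
        (hj := gen_zero_pow_zpow_injective hN) (Multiplicative.ofAdd 1)
      simpa [mul_inv_eq_iff_eq_mul] using this
    | succ i => simp [← map_mul, ← map_inv, ← map_pow, gen_rel]

@[simp]
theorem toExtension_gen_zero : toExtension hN (gen 0) = HNNExtension.t := by
  simp [toExtension]

@[simp]
theorem toExtension_shift (a : ChainGroup N) :
    toExtension hN (shift a) = HNNExtension.of a :=
  DFunLike.congr_fun (hom_ext (f := (toExtension hN).comp shift)
    (g := HNNExtension.of) fun i => by simp [toExtension, shift]) a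

/-- The inverse of `toExtension`. -/
noncomputable def ofExtension : Extension hN →* ChainGroup N :=
  HNNExtension.lift shift (gen 0) (rangeEquiv_compatible _ _ fun k => by
    have h : gen 0 * gen 1 ^ (Multiplicative.toAdd k) * (gen 0)⁻¹ =
        (gen 1 ^ N : ChainGroup N) ^ (Multiplicative.toAdd k) := by
      rw [← gen_rel 0, conj_zpow]
    simpa [shift, mul_inv_eq_iff_eq_mul] using h)

@[simp]
theorem ofExtension_toExtension (a : ChainGroup N) :
    ofExtension hN (toExtension hN a) = a :=
  DFunLike.congr_fun (hom_ext (f := (ofExtension hN).comp (toExtension hN))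
    (g := MonoidHom.id _) fun i => by
      cases i <;> simp [toExtension, ofExtension, shift]) a

include hN in
theorem shift_injective : Function.Injective (shift : ChainGroup N →* ChainGroup N) :=
  fun a b h => HNNExtension.of_injective
    (φ := rangeEquiv _ _ gen_zero_zpow_injective (gen_zero_pow_zpow_injective hN)) (by
      rw [← toExtension_shift hN, ← toExtension_shift hN, h])

include hN in
/-- There is a homomorphism from the HNN extension to a rationally indicable group whose restriction
to the base group has kernel contained in that of `ρ`. -/
theorem exists_hom_extension {Q : Type} [Group Q] (hQ : RationallyIndicable Q)
    (ρ : ChainGroup N →* Q) :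
    ∃ (W : Type) (_ : Group W) (θ : Extension hN →* W), RationallyIndicable W ∧
      ∀ a, θ (HNNExtension.of a) = 1 → ρ a = 1 := by
  obtain ⟨B, _, x, s, e, hB, hs, he⟩ := exists_affine_group N hN
  let diag : ChainGroup N →* Q ≀ᵣ B :=
    { toFun := fun a => ⟨fun _ => ρ a, x ^ (Multiplicative.toAdd (deg a))⟩
      map_one' := by ext <;> simp
      map_mul' := fun a b => by ext <;> simp [zpow_add] }
  let c : Q ≀ᵣ B := ⟨fun y => (ρ (gen 0) ^ e y)⁻¹, 1⟩
  let F : ChainGroup N →* Q ≀ᵣ B := (MulAut.conj c).toMonoidHom.comp diag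
  have hF0 : F (gen 0) = RegularWreathProduct.inl x := by
    have he' : ∀ y, e (x⁻¹ * y) = e y - 1 := fun y => by
      have := he (x⁻¹ * y)
      rw [mul_inv_cancel_left] at this
      omega
    ext y
    · simp [F, diag, c, deg, he', zpow_sub_one]
      group
    · simp [F, diag, c, deg]
  refine ⟨Q ≀ᵣ B, inferInstance, HNNExtension.lift F (RegularWreathProduct.inl s)
    (rangeEquiv_compatible _ _ fun k => ?_), hQ.regularWreathProduct hB, fun a ha => ?_⟩
  · have h : s * x ^ (Multiplicative.toAdd k) * s⁻¹ = (x ^ N) ^ (Multiplicative.toAdd k) := by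
      rw [← hs, conj_zpow]
    rw [mul_inv_eq_iff_eq_mul] at h
    simp only [zpowersHom_apply, map_zpow, map_pow, hF0]
    simp only [← map_zpow, ← map_pow, ← map_mul, h]
  · rw [HNNExtension.lift_of] at ha
    have hd : diag a = 1 := by simpa [F] using ha
    exact congr_fun (congrArg RegularWreathProduct.left hd) 1

include hN in
theorem rationallyIndicable_range_trunc (m : ℕ) :
    RationallyIndicable (trunc m : ChainGroup N →* ChainGroup N).range := by
  induction m with
  | zero =>
    refine fun H hH => (hH ?_).elim
    have h0 : (trunc 0 : ChainGroup N →* ChainGroup N) = 1 := hom_ext fun i => by simp [trunc]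
    rw [eq_bot_iff]
    rintro ⟨_, y, rfl⟩ -
    simp [h0]
  | succ m ih =>
    obtain ⟨W, _, θ, hW, hθ⟩ := exists_hom_extension hN ih (trunc m).rangeRestrict
    intro H hH
    let κ : H →* Extension hN :=
      (toExtension hN).comp ((trunc (m + 1)).range.subtype.comp H.subtype)
    have hκ : Function.Injective κ :=
      (Function.LeftInverse.injective (ofExtension_toExtension hN)).comp
        (Subtype.val_injective.comp Subtype.val_injective)
    by_cases hker : θ.comp κ = 1
    · obtain ⟨f, hf⟩ := HNNExtension.exists_hom_of_free (H := κ.range) (by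
        rw [Ne, MonoidHom.range_eq_bot_iff]
        obtain ⟨h, hh, h1⟩ := H.bot_or_exists_ne_one.resolve_left hH
        refine MonoidHom.ne_one_iff_exists.2 ⟨⟨h, hh⟩, fun hc => h1 ?_⟩
        simpa using (map_eq_one_iff κ hκ).1 hc) (by
        rintro g a ⟨h, hh⟩
        obtain ⟨b, hb⟩ := h.1.2
        set g' := trunc (m + 1) (ofExtension hN g)
        have h1 : (h : ChainGroup N) = g' * shift (trunc m a) * g'⁻¹ := by
          have h2 : (h : ChainGroup N) = ofExtension hN (κ h) :=
            (ofExtension_toExtension hN _).symm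
          have h3 : trunc (m + 1) (h : ChainGroup N) = h := by rw [← hb, trunc_trunc]
          rw [← h3, h2, hh]
          simp [ofExtension, trunc_shift, g']
        have h4 : θ (HNNExtension.of (trunc m a)) = 1 := by
          have h5 : θ (κ h) = 1 := DFunLike.congr_fun hker h
          have h6 : κ h = toExtension hN (h : ChainGroup N) := rfl
          rw [h6, h1] at h5
          simpa using h5
        have h7 : trunc m a = 1 := by
          simpa [Subtype.ext_iff, trunc_trunc] using hθ _ h4
        have h8 : κ h = toExtension hN (h : ChainGroup N) := rfl
        rw [← hh, h8, h1, h7]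
        simp)
      refine ⟨f.comp κ.rangeRestrict, fun hc => hf ?_⟩
      ext x
      obtain ⟨y, rfl⟩ := κ.rangeRestrict_surjective x
      exact DFunLike.congr_fun hc y
    · exact hW.exists_hom _ hker

include hN in
theorem rationallyIndicable : RationallyIndicable (ChainGroup N) := fun H hH => by
  obtain ⟨h, hh, h1⟩ := H.bot_or_exists_ne_one.resolve_left hH
  obtain ⟨m, hm⟩ := (eventually_trunc_eq h).exists
  refine (rationallyIndicable_range_trunc hN m).exists_hom ((trunc m).rangeRestrict.comp H.subtype)
    (MonoidHom.ne_one_iff_exists.2 ⟨⟨h, hh⟩, fun hc => h1 ?_⟩)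
  rw [← hm]
  exact congrArg Subtype.val hc

end HNN

end ChainGroup

theorem Subgroup.FG.exists_surjective_int {G : Type*} [Group G] {H : Subgroup G} (hH : H.FG)
    (f : H →* Multiplicative ℚ) (hf : f ≠ 1) :
    ∃ g : H →* Multiplicative ℤ, Function.Surjective g := by
  have : Group.FG H := (Group.fg_iff_subgroup_fg H).2 hH
  let g : Additive H →+ ℚ := MonoidHom.toAdditiveLeft f
  have : Module.Finite ℤ g.range := Module.Finite.iff_addGroup_fg.2 inferInstance
  have : Nontrivial g.range := by
    obtain ⟨h, hh⟩ := MonoidHom.ne_one_iff_exists.1 hf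
    exact ⟨⟨⟨_, Additive.ofMul h, rfl⟩, 0, fun e => hh (congrArg Subtype.val e)⟩⟩
  let b := Module.Free.chooseBasis ℤ g.range
  obtain ⟨i⟩ := b.index_nonempty
  refine ⟨AddMonoidHom.toMultiplicativeRight
    ((b.coord i).toAddMonoidHom.comp g.rangeRestrict), fun n => ?_⟩
  obtain ⟨a, ha⟩ := g.rangeRestrict_surjective (Multiplicative.toAdd n • b i)
  refine ⟨a.toMul, ?_⟩
  change Multiplicative.ofAdd (b.coord i (g.rangeRestrict a)) = n
  rw [ha]
  simp

theorem exists_ascending_extension {K : Type} [Group K] (s : K →* K) (hs : Function.Injective s) :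
    ∃ (E : Type) (_ : Group E) (ι : K →* E) (t : E), Function.Injective ι ∧
      ∀ a, t⁻¹ * ι a * t = ι (s a) := by
  refine ⟨HNNExtension K _ _ (rangeEquiv s (MonoidHom.id K) hs Function.injective_id),
    inferInstance, HNNExtension.of, HNNExtension.t, HNNExtension.of_injective _, fun a => ?_⟩
  rw [mul_assoc, inv_mul_eq_iff_eq_mul]
  exact (t_mul_of_rangeEquiv a).symm

section OneRelator

open Filter

variable (n : ℕ)

theorem rhoWord_eq_one_iff {G : Type*} [Group G] (x t : G) :
    rhoWord n x t = 1 ↔ x * (t⁻¹ * x * t) * x⁻¹ = (t⁻¹ * x * t) ^ (n + 1) := by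
  have h : rhoWord n x t =
      t * (x * (t⁻¹ * x * t) * x⁻¹ * ((t⁻¹ * x * t) ^ (n + 1))⁻¹) * t⁻¹ := by
    have : (t⁻¹ * x * t) ^ (n + 1) = t⁻¹ * x ^ (n + 1) * t := by
      simpa using conj_pow (i := n + 1) (a := t⁻¹) (b := x)
    rw [this, rhoWord, zpow_neg, show ((n : ℤ) + 1) = ((n + 1 : ℕ) : ℤ) by simp, zpow_natCast]
    group
  rw [h, conj_eq_one_iff, mul_inv_eq_one]

theorem map_rhoWord {G K : Type*} [Group G] [Group K] (f : G →* K) (x t : G) :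
    f (rhoWord n x t) = rhoWord n (f x) (f t) := by
  simp [rhoWord]

/-- The group `⟨x, t | ρ_n(x,t)⟩`. -/
abbrev OneRelatorGroup : Type :=
  PresentedGroup ({rhoWord n (FreeGroup.of 0) (FreeGroup.of 1)} : Set (FreeGroup (Fin 2)))

namespace OneRelatorGroup

/-- The generator `x`. -/
abbrev x : OneRelatorGroup n := PresentedGroup.of 0

/-- The generator `t`. -/
abbrev t : OneRelatorGroup n := PresentedGroup.of 1

/-- The homomorphism out of the one-relator group determined by a solution of the relation. -/
def lift {K : Type*} [Group K] (a b : K) (h : rhoWord n a b = 1) : OneRelatorGroup n →* K :=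
  PresentedGroup.toGroup (f := ![a, b]) (by
    rintro _ rfl
    simpa [map_rhoWord] using h)

theorem lift_x {K : Type*} [Group K] (a b : K) (h : rhoWord n a b = 1) :
    lift n a b h (x n) = a :=
  PresentedGroup.toGroup.of _

theorem lift_t {K : Type*} [Group K] (a b : K) (h : rhoWord n a b = 1) :
    lift n a b h (t n) = b :=
  PresentedGroup.toGroup.of _

theorem rhoWord_of : rhoWord n (x n) (t n) = 1 := by
  have := PresentedGroup.one_of_mem (Set.mem_singleton (rhoWord n (FreeGroup.of (0 : Fin 2))
    (FreeGroup.of 1)))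
  rwa [map_rhoWord] at this

/-- The exponent sum of `t`. -/
def tDegree : OneRelatorGroup n →* Multiplicative ℤ :=
  lift n 1 (Multiplicative.ofAdd 1) (by simp [rhoWord])

/-- The homomorphism `xᵢ ↦ t⁻ⁱ x tⁱ`. -/
def ofChain : ChainGroup (n + 1) →* OneRelatorGroup n :=
  ChainGroup.lift (fun i => (t n ^ i)⁻¹ * x n * t n ^ i) fun i => by
    have h := (rhoWord_eq_one_iff n (x n) (t n)).1 (rhoWord_of n)
    have h1 : (t n ^ (i + 1))⁻¹ * x n * t n ^ (i + 1) =
        (t n ^ i)⁻¹ * ((t n)⁻¹ * x n * t n) * (t n ^ i)⁻¹⁻¹ := by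
      rw [pow_succ']; group
    rw [h1, conj_pow, ← h]
    group

theorem ofChain_injective : Function.Injective (ofChain n) := by
  obtain ⟨E, _, ι, t, hι, ht⟩ := exists_ascending_extension
    (ChainGroup.shift (N := n + 1)) (ChainGroup.shift_injective n.succ_ne_zero)
  let f : OneRelatorGroup n →* E := lift n (ι (ChainGroup.gen 0)) t (by
    rw [rhoWord_eq_one_iff, ht]
    simpa [ChainGroup.shift] using congrArg ι (ChainGroup.gen_rel 0))
  have hf : f.comp (ofChain n) = ι := by
    refine ChainGroup.hom_ext fun i => ?_
    have hi : ι (ChainGroup.gen i) = (t ^ i)⁻¹ * ι (ChainGroup.gen 0) * t ^ i := by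
      induction i with
      | zero => simp
      | succ i ih =>
        have := ht (ChainGroup.gen i)
        rw [ih, ChainGroup.shift, ChainGroup.lift_gen] at this
        rw [← this, pow_succ]
        group
    simp [ofChain, f, lift_x, lift_t, hi]
  exact Function.Injective.of_comp (f := f) (by rwa [← MonoidHom.coe_comp, hf])

theorem eventually_conj_mem_range (g : OneRelatorGroup n) :
    ∀ᶠ k : ℤ in atTop, (t n ^ k)⁻¹ * g * t n ^ (k - Multiplicative.toAdd (tDegree n g)) ∈
      (ofChain n).range := by
  let S : Subgroup (OneRelatorGroup n) :=
    { carrier := {g | ∀ᶠ k : ℤ in atTop,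
        (t n ^ k)⁻¹ * g * t n ^ (k - Multiplicative.toAdd (tDegree n g)) ∈
          (ofChain n).range}
      one_mem' := Eventually.of_forall fun k => by
        simp only [map_one, toAdd_one, sub_zero, mul_one, inv_mul_cancel, one_mem]
      mul_mem' := fun {a b} ha hb => by
        have hb' := (tendsto_atTop_add_const_right atTop
          (-Multiplicative.toAdd (tDegree n a)) tendsto_id).eventually hb
        filter_upwards [ha, hb'] with k h1 h2
        convert mul_mem h1 h2 using 1
        simp only [id, map_mul, toAdd_mul]
        group
      inv_mem' := fun {a} ha => by
        have ha' := (tendsto_atTop_add_const_right atTop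
          (Multiplicative.toAdd (tDegree n a)) tendsto_id).eventually ha
        filter_upwards [ha'] with k h1
        convert inv_mem h1 using 1
        simp only [id, map_inv, toAdd_inv]
        group }
  refine PresentedGroup.generated_by _ S (fun i => ?_) g
  fin_cases i
  · filter_upwards [eventually_ge_atTop 0] with k hk
    obtain ⟨m, rfl⟩ := Int.eq_ofNat_of_zero_le hk
    refine ⟨ChainGroup.gen m, ?_⟩
    simp [ofChain, tDegree, lift_x]
  · refine Eventually.of_forall fun k => ?_
    have : (t n ^ k)⁻¹ * t n * t n ^ (k - Multiplicative.toAdd (tDegree n (t n))) = 1 := by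
      simp only [tDegree, lift_t, toAdd_ofAdd]
      group
    simp only [Fin.mk_one]
    rw [this]
    exact one_mem _

end OneRelatorGroup

end OneRelator

/-- For `n ≥ 1`, the one-relator presented group `⟨x, t | ρ_n(x,t)⟩` is
locally indicable. -/
theorem oneRelator_locallyIndicable (n : ℕ) (hn : 1 ≤ n) :
    LocallyIndicable
      (PresentedGroup ({rhoWord n (FreeGroup.of 0) (FreeGroup.of 1)} :
        Set (FreeGroup (Fin 2)))) := by
  intro H hH hfg
  suffices h : ∃ f : H →* Multiplicative ℚ, f ≠ 1 by
    obtain ⟨f, hf⟩ := h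
    exact hfg.exists_surjective_int f hf
  by_cases hdeg : (OneRelatorGroup.tDegree n).comp H.subtype = 1
  · obtain ⟨S, rfl⟩ := hfg
    obtain ⟨k, hk⟩ := ((Filter.eventually_all_finset S).2
      fun g _ => OneRelatorGroup.eventually_conj_mem_range n g).exists
    let c : MulAut (OneRelatorGroup n) := MulAut.conj ((OneRelatorGroup.t n ^ k)⁻¹)
    have hle : Subgroup.closure (S : Set (OneRelatorGroup n)) ≤
        (OneRelatorGroup.ofChain n).range.comap c.toMonoidHom := by
      rw [Subgroup.closure_le]
      intro g hg
      have h0 : OneRelatorGroup.tDegree n g = 1 :=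
        DFunLike.congr_fun hdeg ⟨g, Subgroup.subset_closure hg⟩
      have := hk g hg
      rw [h0, toAdd_one, sub_zero] at this
      change (OneRelatorGroup.t n ^ k)⁻¹ * g * (OneRelatorGroup.t n ^ k)⁻¹⁻¹ ∈
        (OneRelatorGroup.ofChain n).range
      rwa [inv_inv]
    let f : Subgroup.closure (S : Set (OneRelatorGroup n)) →* (OneRelatorGroup.ofChain n).range :=
      (c.toMonoidHom.comp (Subgroup.subtype _)).codRestrict _ fun g => hle g.2
    let e := MonoidHom.ofInjective (OneRelatorGroup.ofChain_injective n)
    obtain ⟨h, hh, h1⟩ := (Subgroup.bot_or_exists_ne_one _).resolve_left hH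
    refine (ChainGroup.rationallyIndicable n.succ_ne_zero).exists_hom
      (e.symm.toMonoidHom.comp f) (MonoidHom.ne_one_iff_exists.2 ⟨⟨h, hh⟩, fun hc => h1 ?_⟩)
    have h2 : f ⟨h, hh⟩ = 1 := (map_eq_one_iff e.symm e.symm.injective).1 hc
    exact (map_eq_one_iff c c.injective).1 (congrArg Subtype.val h2)
  · exact RationallyIndicable.multiplicative_int.exists_hom _ hdeg
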